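/- If c is a natural number with μ(c) = μ(0) + c, then μ(t) = μ(0) + t for every natural number t with 0 ≤ t ≤ c. -/

import Mathlib

open scoped Classical

/-- The degree of a vertex `v` under an edge-weight assignment `x`:
the sum of the weights of the edges of `G` incident to `v`. -/
noncomputable def bmDeg {V : Type*} [Fintype V] (G : SimpleGraph V)
    (x : Sym2 V → ℕ) (v : V) : ℕ :=
  ∑ e ∈ Finset.univ.filter (fun e : Sym2 V => e ∈ G.edgeSet ∧ v ∈ e), x e

/-- The cardinality `‖x‖₁` of an edge-weight assignment `x`. -/
noncomputable def bmCard {V : Type*} [Fintype V] (G : SimpleGraph V)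
    (x : Sym2 V → ℕ) : ℕ :=
  ∑ e ∈ Finset.univ.filter (fun e : Sym2 V => e ∈ G.edgeSet), x e

/-- `x` is a `b`-matching of `(G, b)`: it is supported on the edges of `G`
and the degree of every vertex `v` is at most `b v`. -/
def IsBMatching {V : Type*} [Fintype V] (G : SimpleGraph V) (b : V → ℕ)
    (x : Sym2 V → ℕ) : Prop :=
  (∀ e, e ∉ G.edgeSet → x e = 0) ∧ ∀ v, bmDeg G x v ≤ b v

/-- The maximum cardinality of a `b`-matching of `(G, b)`. -/
noncomputable def maxBM {V : Type*} [Fintype V] (G : SimpleGraph V) (b : V → ℕ) : ℕ :=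
  sSup {m | ∃ x, IsBMatching G b x ∧ bmCard G x = m}

/-- `mu G b w t` : the maximum cardinality of a `b`-matching of `G` when the
capacity of `w` is set to `t` and every other vertex `v` has capacity `b v`. -/
noncomputable def mu {V : Type*} [Fintype V] (G : SimpleGraph V) (b : V → ℕ)
    (w : V) (t : ℕ) : ℕ :=
  maxBM G (Function.update b w t)


lemma bm_bdd {V : Type*} [Fintype V] (G : SimpleGraph V) (b : V → ℕ) :
    BddAbove {m | ∃ x, IsBMatching G b x ∧ bmCard G x = m} := by
  refine ⟨∑ e ∈ Finset.univ.filter (fun e : Sym2 V => e ∈ G.edgeSet), ∑ v, b v, ?_⟩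
  rintro m ⟨x, hx, rfl⟩
  refine Finset.sum_le_sum fun e he => ?_
  have he' : e ∈ G.edgeSet := by simpa using he
  obtain ⟨v, hv⟩ : ∃ v, v ∈ e := ⟨_, e.out_fst_mem⟩
  have h1 : x e ≤ bmDeg G x v :=
    Finset.single_le_sum (f := x) (fun _ _ => Nat.zero_le _) (by simp [he', hv])
  have h2 : b v ≤ ∑ v, b v :=
    Finset.single_le_sum (f := b) (fun _ _ => Nat.zero_le _) (Finset.mem_univ v)
  exact h1.trans ((hx.2 v).trans h2)

lemma mu_succ_le {V : Type*} [Fintype V] (G : SimpleGraph V) (b : V → ℕ)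
    (w : V) (t : ℕ) : mu G b w (t + 1) ≤ mu G b w t + 1 := by
  unfold mu
  refine csSup_le ⟨0, fun _ => 0, ⟨by simp, by simp [bmDeg]⟩, by simp [bmCard]⟩ ?_
  rintro m ⟨x, hx, rfl⟩
  by_cases hw : bmDeg G x w ≤ t
  · refine le_trans (le_csSup (bm_bdd G _) ⟨x, ⟨hx.1, fun v => ?_⟩, rfl⟩) (Nat.le_succ _)
    by_cases hv : v = w
    · subst hv; simpa using hw
    · simpa [hv] using hx.2 v
  · have hpos : bmDeg G x w ≠ 0 := by omega
    obtain ⟨e, he, hne⟩ := Finset.exists_ne_zero_of_sum_ne_zero hpos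
    simp only [Finset.mem_filter, Finset.mem_univ, true_and] at he
    have hle : ∀ f, Function.update x e (x e - 1) f ≤ x f := by
      intro f
      by_cases hf : f = e
      · subst hf; simp
      · simp [hf]
    have hlt : ∀ s : Finset (Sym2 V), e ∈ s →
        ∑ f ∈ s, Function.update x e (x e - 1) f + 1 = ∑ f ∈ s, x f := by
      intro s hs
      rw [Finset.sum_update_of_mem hs, ← Finset.add_sum_erase s x hs, Finset.sdiff_singleton_eq_erase]
      omega
    have hc : bmCard G (Function.update x e (x e - 1)) + 1 = bmCard G x :=
      hlt _ (by simp [he.1])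
    have hd : bmDeg G (Function.update x e (x e - 1)) w + 1 = bmDeg G x w :=
      hlt _ (by simp [he])
    rw [← hc]
    refine Nat.succ_le_succ (le_csSup (bm_bdd G _) ⟨_, ⟨fun f hf => ?_, fun v => ?_⟩, rfl⟩)
    · have := hle f
      have := hx.1 f hf
      omega
    · by_cases hv : v = w
      · subst hv
        have := hx.2 v
        simp only [Function.update_self] at this ⊢
        omega
      · have h1 := hx.2 v
        rw [Function.update_of_ne hv] at h1 ⊢
        exact le_trans (Finset.sum_le_sum fun f _ => hle f) h1

lemma mu_add_le {V : Type*} [Fintype V] (G : SimpleGraph V) (b : V → ℕ)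
    (w : V) (t k : ℕ) : mu G b w (t + k) ≤ mu G b w t + k := by
  induction k with
  | zero => simp
  | succ k ih =>
    have := mu_succ_le G b w (t + k)
    rw [← add_assoc]
    omega

/-- If `μ(c) = μ(0) + c` then `μ(t) = μ(0) + t` for every `0 ≤ t ≤ c`. -/
theorem mu_linear_below {V : Type*} [Fintype V] (G : SimpleGraph V) (b : V → ℕ)
    (w : V) (c : ℕ) (h : mu G b w c = mu G b w 0 + c) :
    ∀ t : ℕ, t ≤ c → mu G b w t = mu G b w 0 + t := by
  intro t ht
  obtain ⟨k, rfl⟩ := Nat.exists_eq_add_of_le ht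
  have h1 := mu_add_le G b w t k
  have h2 := mu_add_le G b w 0 t
  rw [zero_add] at h2
  omega
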